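/- Let T be a finite tree of order at least 4 with no vertex of degree two and no vertex of degree three, having at least 6 leaves, and let G be a graph obtained from T by adding edges so that the leaves of T form a cycle. Then the distinguishing number of G satisfies D(G) ≤ 2. -/

import Mathlib

open SimpleGraph

/-- The distinguishing number of a graph `G`: the least `d` such that `G` has a vertex
labeling with `d` labels that is preserved only by the identity automorphism. -/
noncomputable def distinguishingNumber {V : Type*} (G : SimpleGraph V) : ℕ :=
  sInf {d | ∃ c : V → Fin d, ∀ f : G ≃g G, (∀ v, c (f v) = c v) → ∀ v, f v = v}

/-- The edge set of `H` is exactly a cycle passing through the set `S`. -/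
def IsCycleOn {V : Type*} (H : SimpleGraph V) (S : Set V) : Prop :=
  ∃ (v : V) (c : H.Walk v v), c.IsCycle ∧ {x | x ∈ c.support} = S ∧
    ∀ e, e ∈ H.edgeSet ↔ e ∈ c.edges

/-- An adjacency-preserving injection of the cycle on `{0, …, n - 1}`, `6 ≤ n`, that maps
`{0, 1, 3}` to itself is the identity. -/
theorem cycle_map_eq_self {n : ℕ} (hn : 6 ≤ n) (g : ℕ → ℕ) (hg : ∀ i < n, g i < n)
    (hinj : ∀ i < n, ∀ j < n, g i = g j → i = j)
    (hadj : ∀ i, i + 1 < n → g i + 1 = g (i + 1) ∨ g (i + 1) + 1 = g i ∨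
      (g i = 0 ∧ g (i + 1) + 1 = n) ∨ (g (i + 1) = 0 ∧ g i + 1 = n))
    (hS : ∀ i < n, i = 0 ∨ i = 1 ∨ i = 3 → g i = 0 ∨ g i = 1 ∨ g i = 3) :
    ∀ i < n, g i = i := by
  have s0 := hS 0 (by omega) (by omega)
  have s1 := hS 1 (by omega) (by omega)
  have s3 := hS 3 (by omega) (by omega)
  have a0 := hadj 0 (by omega)
  have a1 := hadj 1 (by omega)
  have a2 := hadj 2 (by omega)
  norm_num at a0 a1 a2
  have i01 : g 0 ≠ g 1 := fun h => absurd (hinj 0 (by omega) 1 (by omega) h) (by omega)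
  have i03 : g 0 ≠ g 3 := fun h => absurd (hinj 0 (by omega) 3 (by omega) h) (by omega)
  have i13 : g 1 ≠ g 3 := fun h => absurd (hinj 1 (by omega) 3 (by omega) h) (by omega)
  have e3 : g 3 = 3 := by omega
  have e1 : g 1 = 1 := by omega
  have e0 : g 0 = 0 := by omega
  intro i
  induction i using Nat.strong_induction_on with
  | _ i ih =>
    intro hi
    match i, ih, hi with
    | 0, _, _ => exact e0
    | 1, _, _ => exact e1
    | k + 2, ih, hi =>
      have h0 := ih k (by omega) (by omega)
      have h1 := ih (k + 1) (by omega) (by omega)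
      have a := hadj (k + 1) (by omega)
      have hne : g k ≠ g (k + 2) := fun h =>
        absurd (hinj k (by omega) (k + 2) (by omega) h) (by omega)
      have hlt := hg (k + 2) hi
      have e : k + 1 + 1 = k + 2 := rfl
      rw [e] at a
      have := hg k (by omega)
      omega

namespace SimpleGraph

variable {V : Type*}

/-- In a rooted tree, a vertex has at most one neighbor closer to the root. -/
theorem IsTree.eq_of_adj_of_dist_lt {T : SimpleGraph V} (hT : T.IsTree) {r u a b : V}
    (ha : T.Adj a u) (hb : T.Adj b u) (hda : T.dist r u = T.dist r a + 1)
    (hdb : T.dist r u = T.dist r b + 1) : a = b := by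
  obtain ⟨p, hp⟩ := hT.connected.exists_walk_length_eq_dist r a
  obtain ⟨q, hq⟩ := hT.connected.exists_walk_length_eq_dist r b
  have h1 : (p.concat ha).IsPath :=
    Walk.isPath_of_length_eq_dist _ (by rw [Walk.length_concat, hp, hda])
  have h2 : (q.concat hb).IsPath :=
    Walk.isPath_of_length_eq_dist _ (by rw [Walk.length_concat, hq, hdb])
  have h := (hT.existsUnique_path r u).unique h1 h2
  simpa using congrArg Walk.penultimate h

/-- An automorphism of a finite tree that fixes every leaf, and some vertex, is trivial. -/
theorem IsTree.iso_eq_self_of_leaves_fixed [Fintype V] {T : SimpleGraph V} [DecidableRel T.Adj]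
    (hT : T.IsTree) (f : T ≃g T) {r : V} (hr : f r = r)
    (hleaf : ∀ v, T.degree v = 1 → f v = v) (v : V) : f v = v := by
  have hdist_le (e : T ≃g T) (x y : V) : T.dist (e x) (e y) ≤ T.dist x y := by
    obtain ⟨p, hp⟩ := hT.connected.exists_walk_length_eq_dist x y
    rw [← hp, ← Walk.length_map e.toHom p]
    exact dist_le _
  have hdist (x : V) : T.dist r (f x) = T.dist r x := by
    refine le_antisymm (by simpa [hr] using hdist_le f r x) ?_
    have hs : f.symm r = r := by rw [RelIso.symm_apply_eq, hr]
    simpa [hs] using hdist_le f.symm r (f x)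
  obtain ⟨N, hN⟩ : ∃ N, ∀ x, T.dist r x ≤ N := by
    refine ⟨Finset.univ.sup (T.dist r), fun x => Finset.le_sup (Finset.mem_univ x)⟩
  induction hk : N - T.dist r v using Nat.strong_induction_on generalizing v with
  | _ k ih =>
    by_cases hv : T.degree v = 1
    · exact hleaf v hv
    by_cases hvr : v = r
    · rw [hvr, hr]
    obtain ⟨u, hu, hdu⟩ : ∃ u, T.Adj v u ∧ T.dist r u = T.dist r v + 1 := by
      by_contra! hno
      apply hv
      obtain ⟨w, hw⟩ : (T.neighborFinset v).Nonempty := by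
        rw [← Finset.card_pos, card_neighborFinset_eq_degree]
        have : Nontrivial V := ⟨v, r, hvr⟩
        exact hT.connected.preconnected.degree_pos_of_nontrivial v
      have hpar : ∀ x, T.Adj v x → T.dist r v = T.dist r x + 1 := fun x hx =>
        (hT.dist_eq_dist_add_one_of_adj r hx).resolve_right (hno x hx)
      rw [← card_neighborFinset_eq_degree, Finset.card_eq_one]
      rw [mem_neighborFinset] at hw
      refine ⟨w, Finset.eq_singleton_iff_unique_mem.2 ⟨by simpa using hw, fun x hx => ?_⟩⟩
      rw [mem_neighborFinset] at hx
      exact hT.eq_of_adj_of_dist_lt hx.symm hw.symm (hpar x hx) (hpar w hw)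
    have hfu : f u = u := ih (N - T.dist r u) (by have := hN u; omega) u rfl
    have hadj : T.Adj (f v) u := by
      rw [← hfu]; exact f.map_adj_iff.2 hu
    exact hT.eq_of_adj_of_dist_lt hadj hu (by rw [hdist, hdu]) hdu

/-- In a tree with at least three vertices, no two leaves are adjacent. -/
theorem Connected.not_adj_of_degree_eq_one [Fintype V] {T : SimpleGraph V}
    [DecidableRel T.Adj] (hT : T.Connected) (hcard : 3 ≤ Fintype.card V) {x y : V}
    (hx : T.degree x = 1) (hy : T.degree y = 1) : ¬ T.Adj x y := by
  classical
  intro h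
  obtain ⟨a, ha⟩ := Finset.card_eq_one.1 (T.card_neighborFinset_eq_degree x ▸ hx)
  obtain ⟨b, hb⟩ := Finset.card_eq_one.1 (T.card_neighborFinset_eq_degree y ▸ hy)
  have ha' : ∀ z, T.Adj x z ↔ z = a := fun z => by
    rw [← mem_neighborFinset, ha, Finset.mem_singleton]
  have hb' : ∀ z, T.Adj y z ↔ z = b := fun z => by
    rw [← mem_neighborFinset, hb, Finset.mem_singleton]
  obtain ⟨z, hz⟩ : ∃ z, z ∉ ({x, y} : Finset V) := by
    by_contra! hall
    have h1 : Fintype.card V ≤ ({x, y} : Finset V).card :=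
      Finset.card_le_card fun z _ => hall z
    have := Finset.card_le_two (a := x) (b := y)
    omega
  obtain ⟨p⟩ := hT.preconnected x z
  obtain ⟨d, -, hd1, hd2⟩ := p.exists_boundary_dart {w | w = x ∨ w = y} (Or.inl rfl)
    (by simpa using hz)
  have hd := d.adj
  simp only [Set.mem_ofPred_eq, not_or] at hd1 hd2
  rcases hd1 with e | e
  · rw [e, ha'] at hd
    exact hd2.2 (hd.trans ((ha' y).1 h).symm)
  · rw [e, hb'] at hd
    exact hd2.1 (hd.trans ((hb' x).1 h.symm).symm)

end SimpleGraph

/-- A graph whose edges form a cycle admits an enumeration of the vertices of the cycle by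
`{0, …, n - 1}` under which adjacency is cyclic succession. -/
theorem IsCycleOn.exists_enumeration {V : Type*} {H : SimpleGraph V} {S : Set V}
    (h : IsCycleOn H S) : ∃ (n : ℕ) (p : ℕ → V), Set.InjOn p (Set.Iio n) ∧ p '' Set.Iio n = S ∧
      (∀ i, i + 1 < n → H.Adj (p i) (p (i + 1))) ∧
      (∀ i < n, ∀ j < n, H.Adj (p i) (p j) →
        i + 1 = j ∨ j + 1 = i ∨ (i = 0 ∧ j + 1 = n) ∨ (j = 0 ∧ i + 1 = n)) := by
  obtain ⟨v, c, hc, rfl, hE⟩ := h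
  have h3 := hc.three_le_length
  have hinj : Set.InjOn c.getVert (Set.Iio c.length) := fun i hi j hj hij =>
    hc.getVert_injOn' (by simp at hi ⊢; omega) (by simp at hj ⊢; omega) hij
  have hinj' : ∀ i < c.length, ∀ j < c.length, c.getVert i = c.getVert j → i = j :=
    fun i hi j hj hij => hinj hi hj hij
  refine ⟨c.length, c.getVert, hinj, ?_, ?_, ?_⟩
  · ext x
    simp only [Set.mem_image, Set.mem_Iio, Set.mem_ofPred_eq, Walk.mem_support_iff_exists_getVert]
    constructor
    · rintro ⟨i, hi, rfl⟩
      exact ⟨i, rfl, hi.le⟩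
    · rintro ⟨i, rfl, hi⟩
      rcases hi.lt_or_eq with hi | rfl
      · exact ⟨i, hi, rfl⟩
      · exact ⟨0, by omega, by simp⟩
  · intro i hi
    exact c.adj_getVert_succ (by omega)
  · intro i hi j hj hij
    obtain ⟨k, hk, e⟩ := (c.mk_mem_edges_iff_exists).1 ((hE _).1 hij)
    obtain ⟨m, hm, hkm, hm'⟩ : ∃ m < c.length, c.getVert (k + 1) = c.getVert m ∧
        (m = k + 1 ∨ (m = 0 ∧ k + 1 = c.length)) := by
      by_cases hk' : k + 1 < c.length
      · exact ⟨k + 1, hk', rfl, Or.inl rfl⟩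
      · have : k + 1 = c.length := by omega
        exact ⟨0, by omega, by rw [this]; simp, Or.inr ⟨rfl, this⟩⟩
    rw [hkm, Sym2.eq_iff] at e
    rcases e with ⟨e1, e2⟩ | ⟨e1, e2⟩
    · have := hinj' _ hk _ hi e1
      have := hinj' _ hm _ hj e2
      omega
    · have := hinj' _ hk _ hj e1
      have := hinj' _ hm _ hi e2
      omega

/-- Every edge of a cycle through `S` has its ends in `S`. -/
theorem IsCycleOn.mem_of_adj {V : Type*} {H : SimpleGraph V} {S : Set V}
    (h : IsCycleOn H S) {x y : V} (hxy : H.Adj x y) : x ∈ S := by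
  obtain ⟨v, c, -, rfl, hE⟩ := h
  exact c.fst_mem_support_of_mem_edges ((hE _).1 hxy)

/-- Every vertex of a cycle has exactly two neighbors in it. -/
theorem IsCycleOn.ncard_neighborSet {V : Type*} {H : SimpleGraph V} {S : Set V}
    (h : IsCycleOn H S) {x : V} (hx : x ∈ S) : (H.neighborSet x).ncard = 2 := by
  obtain ⟨v, c, hc, rfl, hE⟩ := h
  rw [← hc.ncard_neighborSet_toSubgraph_eq_two hx]
  congr 1
  ext y
  rw [mem_neighborSet, Subgraph.mem_neighborSet, Walk.adj_toSubgraph_iff_mem_edges, ← hE,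
    mem_edgeSet]

/-- If a graph is the union of a cycle through the leaves of a tree and the tree, and the tree has
no vertex of degree two or three, then automorphisms map leaves to leaves. -/
theorem IsCycleOn.degree_iso_eq_one {V : Type*} [Fintype V] {T C : SimpleGraph V}
    [DecidableRel T.Adj] (hC : IsCycleOn C {v : V | T.degree v = 1})
    (hdeg2 : ∀ v : V, T.degree v ≠ 2) (hdeg3 : ∀ v : V, T.degree v ≠ 3)
    (hpos : ∀ v : V, 0 < T.degree v) (f : (T ⊔ C) ≃g (T ⊔ C)) {v : V}
    (hv : T.degree v = 1) : T.degree (f v) = 1 := by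
  classical
  have hTn (x : V) : (T.neighborSet x).ncard = T.degree x := by
    rw [Set.ncard_eq_toFinset_card', ← card_neighborFinset_eq_degree]
    rfl
  have hle : ((T ⊔ C).neighborSet v).ncard ≤ 3 := by
    have : (T ⊔ C).neighborSet v = T.neighborSet v ∪ C.neighborSet v := by
      ext; simp
    rw [this]
    refine (Set.ncard_union_le _ _).trans ?_
    rw [hTn, hv, hC.ncard_neighborSet hv]
  have himg : (T ⊔ C).neighborSet (f v) = f '' (T ⊔ C).neighborSet v := by
    ext y
    constructor
    · intro hy
      refine ⟨f.symm y, ?_, by simp⟩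
      rw [mem_neighborSet, ← f.map_adj_iff]
      simpa using hy
    · rintro ⟨z, hz, rfl⟩
      exact f.map_adj_iff.2 hz
  have hge : T.degree (f v) ≤ ((T ⊔ C).neighborSet (f v)).ncard := by
    rw [← hTn]
    exact Set.ncard_le_ncard (fun y hy => Or.inl hy)
  rw [himg, Set.ncard_image_of_injective _ f.injective] at hge
  have := hdeg2 (f v)
  have := hdeg3 (f v)
  have := hpos (f v)
  omega

/-- If `T` is a tree of order at least four with no vertex of degree two or three and
at least six leaves, and `G` is obtained from `T` by adding a cycle through the leaves
of `T`, then `D(G) ≤ 2`. -/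
theorem halin_distinguishingNumber_le_two {V : Type*} [Fintype V] [DecidableEq V]
    (T C G : SimpleGraph V) [DecidableRel T.Adj]
    (hT : T.IsTree) (horder : 4 ≤ Fintype.card V)
    (hdeg2 : ∀ v : V, T.degree v ≠ 2)
    (hC : IsCycleOn C {v : V | T.degree v = 1})
    (hdisj : Disjoint T C)
    (hG : G = T ⊔ C)
    (hdeg3 : ∀ v : V, T.degree v ≠ 3)
    (hleaves : 6 ≤ {v : V | T.degree v = 1}.ncard) :
    distinguishingNumber G ≤ 2 := by
  subst hG
  have : Nontrivial V := Fintype.one_lt_card_iff_nontrivial.1 (by omega)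
  have hpos (v : V) : 0 < T.degree v := hT.connected.preconnected.degree_pos_of_nontrivial v
  have hTleaf {x y : V} (hx : T.degree x = 1) (hy : T.degree y = 1) : ¬ T.Adj x y :=
    hT.connected.not_adj_of_degree_eq_one (by omega) hx hy
  obtain ⟨n, p, hinj, himg, hsucc, hadj⟩ := hC.exists_enumeration
  have hn : 6 ≤ n := by
    rw [← himg, hinj.ncard_image, ← Finset.coe_Iio, Set.ncard_coe_finset] at hleaves
    simpa using hleaves
  have hp (i : ℕ) (hi : i < n) : T.degree (p i) = 1 :=
    himg.subset (Set.mem_image_of_mem p (Set.mem_Iio.2 hi))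
  have hsurj (v : V) (hv : T.degree v = 1) : ∃ i < n, p i = v := himg.superset hv
  apply Nat.sInf_le
  refine ⟨fun v => if v = p 0 ∨ v = p 1 ∨ v = p 3 then 1 else 0, fun f hf => ?_⟩
  have hleaf (g : (T ⊔ C) ≃g (T ⊔ C)) {v : V} (hv : T.degree v = 1) : T.degree (g v) = 1 :=
    hC.degree_iso_eq_one hdeg2 hdeg3 hpos g hv
  have hleaf_iff (v : V) : T.degree (f v) = 1 ↔ T.degree v = 1 :=
    ⟨fun h => f.symm_apply_apply v ▸ hleaf f.symm h, hleaf f⟩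
  have hTadj (x y : V) : T.Adj x y ↔ (T ⊔ C).Adj x y ∧ ¬ (T.degree x = 1 ∧ T.degree y = 1) :=
    ⟨fun h => ⟨Or.inl h, fun hxy => hTleaf hxy.1 hxy.2 h⟩,
      fun h => h.1.resolve_right fun hc => h.2 ⟨hC.mem_of_adj hc, hC.mem_of_adj hc.symm⟩⟩
  let fT : T ≃g T := ⟨f.toEquiv, fun {x y} => by
    change T.Adj (f x) (f y) ↔ T.Adj x y
    rw [hTadj, hTadj x y, hleaf_iff, hleaf_iff, f.map_adj_iff]⟩
  choose! g hgn hgp using fun i hi => hsurj (f (p i)) (hleaf f (hp i hi))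
  have hg : ∀ i < n, g i = i := by
    refine cycle_map_eq_self hn g hgn (fun i hi j hj h => ?_) (fun i hi => ?_)
      (fun i hi h => ?_)
    · apply hinj hi hj
      apply f.injective
      rw [← hgp i hi, ← hgp j hj, h]
    · apply hadj _ (hgn i (by omega)) _ (hgn (i + 1) hi)
      rw [hgp i (by omega), hgp (i + 1) hi]
      have h : (T ⊔ C).Adj (f (p i)) (f (p (i + 1))) := f.map_adj_iff.2 (Or.inr (hsucc i hi))
      exact h.resolve_left (hTleaf (hleaf f (hp i (by omega))) (hleaf f (hp (i + 1) hi)))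
    · have hc := hf (p i)
      have h1 : p i = p 0 ∨ p i = p 1 ∨ p i = p 3 := by
        rcases h with rfl | rfl | rfl <;> simp
      simp only [if_pos h1] at hc
      have h2 : f (p i) = p 0 ∨ f (p i) = p 1 ∨ f (p i) = p 3 := by
        by_contra h2
        simp [if_neg h2] at hc
      rw [← hgp i hi] at h2
      have hlt := hgn i hi
      rcases h2 with h2 | h2 | h2
      · exact Or.inl (hinj hlt (Set.mem_Iio.2 (by omega)) h2)
      · exact Or.inr (Or.inl (hinj hlt (Set.mem_Iio.2 (by omega)) h2))
      · exact Or.inr (Or.inr (hinj hlt (Set.mem_Iio.2 (by omega)) h2))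
  have hfix (v : V) (hv : T.degree v = 1) : fT v = v := by
    obtain ⟨i, hi, rfl⟩ := hsurj v hv
    change f (p i) = p i
    rw [← hgp i hi, hg i hi]
  exact hT.iso_eq_self_of_leaves_fixed fT (hfix (p 0) (hp 0 (by omega))) hfix
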